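/- Fix a probability measure π on Θ. For every real β with 0 < β < N, P[ π_{exp(−β r(·,ω))}( r(·,ω) ) ] ≤ P[ π_{exp(−β r(·,ω))}( R ) ] ≤ inf over λ > −N log(1 − β/N) of ( (λ − β) / ( N(1 − exp(−λ/N)) − β ) ) · P[ π_{exp(−β r(·,ω))}( r(·,ω) ) ]; in particular, when β < N/2, P[ π_{exp(−β r(·,ω))}( R ) ] ≤ ( 1 − 2β/N )^{-1} P[ π_{exp(−β r(·,ω))}( r(·,ω) ) ]. -/

import Mathlib

open MeasureTheory ProbabilityTheory

/-- `Φ_a(p) = -a⁻¹ log(1 - (1 - e^{-a}) p)` for `a ≠ 0`, and `Φ_0(p) = p`. -/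
noncomputable def Phi (a p : ℝ) : ℝ :=
  if a = 0 then p else -a⁻¹ * Real.log (1 - (1 - Real.exp (-a)) * p)

/-- `Φ_a⁻¹(q) = (1 - e^{-aq})/(1 - e^{-a})` for `a ≠ 0`, and `Φ_0⁻¹(q) = q`. -/
noncomputable def PhiInv (a q : ℝ) : ℝ :=
  if a = 0 then q else (1 - Real.exp (-(a * q))) / (1 - Real.exp (-a))

/-- Kullback–Leibler divergence `K(ρ,π) = ∫ log (dρ/dπ) dρ` (as a real number;
meaningful under `KLFin ρ π`). -/
noncomputable def KL {Θ : Type*} [MeasurableSpace Θ] (ρ π : Measure Θ) : ℝ :=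
  ∫ θ, Real.log ((ρ.rnDeriv π θ).toReal) ∂ρ

/-- Finiteness of the Kullback–Leibler divergence: `ρ ≪ π` and `log (dρ/dπ)`
is `ρ`-integrable. -/
def KLFin {Θ : Type*} [MeasurableSpace Θ] (ρ π : Measure Θ) : Prop :=
  ρ ≪ π ∧ Integrable (fun θ => Real.log ((ρ.rnDeriv π θ).toReal)) ρ

/-- The Gibbs measure `π_{exp h}` with density `exp h / π[exp h]` with respect to `π`. -/
noncomputable def Gibbs {Θ : Type*} [MeasurableSpace Θ] (π : Measure Θ) (h : Θ → ℝ) :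
    Measure Θ :=
  (ENNReal.ofReal (∫ θ, Real.exp (h θ) ∂π))⁻¹ •
    π.withDensity (fun θ => ENNReal.ofReal (Real.exp (h θ)))

/-- Empirical error rate `r(θ,ω) = N⁻¹ ∑ᵢ 1[f_θ(X_i) ≠ Y_i]`. -/
noncomputable def empErr {𝒳 𝒴 Θ : Type*} [DecidableEq 𝒴] (N : ℕ)
    (f : Θ → 𝒳 → 𝒴) (θ : Θ) (ω : Fin N → 𝒳 × 𝒴) : ℝ :=
  (N : ℝ)⁻¹ * ∑ i, if f θ (ω i).1 = (ω i).2 then 0 else 1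

/-- Expected error rate `R(θ) = N⁻¹ ∑ᵢ P[f_θ(X_i) ≠ Y_i]`. -/
noncomputable def expErr {𝒳 𝒴 Θ : Type*} [MeasurableSpace 𝒳] [MeasurableSpace 𝒴] (N : ℕ)
    (P : Measure (Fin N → 𝒳 × 𝒴)) (f : Θ → 𝒳 → 𝒴) (θ : Θ) : ℝ :=
  (N : ℝ)⁻¹ * ∑ i, (P {ω | f θ (ω i).1 ≠ (ω i).2}).toReal

lemma integrable_of_measurable_of_abs_le {α : Type*} [MeasurableSpace α] {μ : Measure α}
    [IsFiniteMeasure μ] {g : α → ℝ} (hg : Measurable g) {C : ℝ} (hC : ∀ x, |g x| ≤ C) :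
    Integrable g μ :=
  Integrable.of_bound hg.aestronglyMeasurable C (Filter.Eventually.of_forall hC)

lemma integrable_exp_of_measurable_of_abs_le {α : Type*} [MeasurableSpace α] {μ : Measure α}
    [IsFiniteMeasure μ] {g : α → ℝ} (hg : Measurable g) {C : ℝ} (hC : ∀ x, |g x| ≤ C) :
    Integrable (fun x => Real.exp (g x)) μ :=
  integrable_of_measurable_of_abs_le hg.exp (C := Real.exp C) fun x => by
    rw [abs_of_pos (Real.exp_pos _)]
    exact Real.exp_le_exp.2 (le_of_abs_le (hC x))

lemma Gibbs_eq_tilted {Θ : Type*} [MeasurableSpace Θ] (π : Measure Θ) [NeZero π] {h : Θ → ℝ}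
    (hh : Integrable (fun θ => Real.exp (h θ)) π) : Gibbs π h = π.tilted h := by
  have hZ : 0 < ∫ θ, Real.exp (h θ) ∂π := integral_exp_pos hh
  unfold Gibbs Measure.tilted
  rw [← withDensity_smul' _ _ (by simp [hZ])]
  congr 1
  ext θ
  rw [Pi.smul_apply, smul_eq_mul, ENNReal.ofReal_div_of_pos hZ, div_eq_mul_inv, mul_comm]

/-- Donsker–Varadhan inequality for an exponentially tilted measure. -/
lemma integral_tilted_le_log_sub_log {Θ : Type*} [MeasurableSpace Θ] (π : Measure Θ)
    [IsProbabilityMeasure π] {h g : Θ → ℝ} (hh : Measurable h) (hg : Measurable g) {C D : ℝ}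
    (hC : ∀ θ, |h θ| ≤ C) (hD : ∀ θ, |g θ| ≤ D) :
    ∫ θ, g θ ∂(π.tilted h) ≤
      Real.log (∫ θ, Real.exp (h θ + g θ) ∂π) - Real.log (∫ θ, Real.exp (h θ) ∂π) := by
  have hexp := integrable_exp_of_measurable_of_abs_le (μ := π) hh hC
  have hexp' := integrable_exp_of_measurable_of_abs_le (μ := π) (hh.add hg) (C := C + D)
    fun θ => (abs_add_le _ _).trans (add_le_add (hC θ) (hD θ))
  have := isProbabilityMeasure_tilted hexp
  have jensen : Real.exp (∫ θ, g θ ∂(π.tilted h)) ≤ ∫ θ, Real.exp (g θ) ∂(π.tilted h) :=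
    convexOn_exp.map_integral_le Real.continuous_exp.continuousOn isClosed_univ (by simp)
      (integrable_of_measurable_of_abs_le hg hD) (integrable_exp_of_measurable_of_abs_le hg hD)
  rw [integral_exp_tilted] at jensen
  refine le_of_le_of_eq ?_ (Real.log_div (integral_exp_pos hexp').ne' (integral_exp_pos hexp).ne')
  exact (Real.le_log_iff_exp_le (div_pos (integral_exp_pos hexp') (integral_exp_pos hexp))).2
    jensen

/-- A Laplace transform bound `P[exp(-λ r)] ≤ exp(-a R)`, integrated against the Gibbs posterior
`π_{exp(-β r)}`, controls the posterior risk by the posterior empirical risk. -/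
lemma integral_gibbs_posterior_le {Θ Ω : Type*} [MeasurableSpace Θ] [MeasurableSpace Ω]
    (π : Measure Θ) [IsProbabilityMeasure π] (P : Measure Ω) [IsProbabilityMeasure P]
    {r : Θ → Ω → ℝ} {R : Θ → ℝ} (hr : Measurable (Function.uncurry r))
    (hr01 : ∀ θ ω, r θ ω ∈ Set.Icc (0 : ℝ) 1) (hR : ∀ θ, R θ = ∫ ω, r θ ω ∂P) (β lam a : ℝ)
    (hLaplace : ∀ θ, ∫ ω, Real.exp (-(lam * r θ ω)) ∂P ≤ Real.exp (-(a * R θ))) :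
    (a - β) * ∫ ω, (∫ θ, R θ ∂(Gibbs π fun θ' => -(β * r θ' ω))) ∂P ≤
      (lam - β) * ∫ ω, (∫ θ, r θ ω ∂(Gibbs π fun θ' => -(β * r θ' ω))) ∂P := by
  have hrθ : ∀ ω, Measurable fun θ => r θ ω := fun ω => hr.comp measurable_prodMk_right
  have hrω : ∀ θ, Measurable (r θ) := fun θ => hr.comp measurable_prodMk_left
  have hr' : ∀ θ ω, |r θ ω| ≤ 1 := fun θ ω => by
    rw [abs_of_nonneg (hr01 θ ω).1]; exact (hr01 θ ω).2
  have hrint : ∀ θ, Integrable (r θ) P := fun θ =>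
    integrable_of_measurable_of_abs_le (hrω θ) (hr' θ)
  have hRm : Measurable R := by
    rw [funext hR]
    exact (hr.stronglyMeasurable.integral_prod_right (ν := P)).measurable
  have hR' : ∀ θ, |R θ| ≤ 1 := fun θ => by
    rw [hR θ]
    refine (norm_integral_le_of_norm_le_const (f := r θ) (C := 1)
      (Filter.Eventually.of_forall fun ω => hr' θ ω)).trans ?_
    simp
  have hlin : ∀ (b c : ℝ) θ ω, |b * R θ + c * r θ ω| ≤ |b| + |c| := fun b c θ ω => by
    refine (abs_add_le _ _).trans ?_
    rw [abs_mul, abs_mul]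
    nlinarith [hR' θ, hr' θ ω, abs_nonneg b, abs_nonneg c]
  have hlinm : ∀ (b c : ℝ) ω, Measurable fun θ => b * R θ + c * r θ ω := fun b c ω =>
    (hRm.const_mul b).add ((hrθ ω).const_mul c)
  have hlinm2 : ∀ b c : ℝ, Measurable fun p : Θ × Ω => b * R p.1 + c * r p.1 p.2 := fun b c =>
    ((hRm.comp measurable_fst).const_mul b).add (hr.const_mul c)
  have hbr : ∀ ω θ, |-(β * r θ ω)| ≤ |β| := fun ω θ => by
    simpa using hlin 0 (-β) θ ω
  have hbrm : ∀ ω, Measurable fun θ => -(β * r θ ω) := fun ω => ((hrθ ω).const_mul β).neg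
  have hbR : ∀ θ, |-(β * R θ)| ≤ |β| := fun θ => by
    rw [abs_neg, abs_mul]; nlinarith [hR' θ, abs_nonneg β]
  have hbRm : Measurable fun θ => -(β * R θ) := (hRm.const_mul β).neg
  have hexp : ∀ ω, Integrable (fun θ => Real.exp (-(β * r θ ω))) π := fun ω =>
    integrable_exp_of_measurable_of_abs_le (hbrm ω) (hbr ω)
  have hexpR : Integrable (fun θ => Real.exp (-(β * R θ))) π :=
    integrable_exp_of_measurable_of_abs_le hbRm hbR
  have hprob : ∀ ω, IsProbabilityMeasure (π.tilted fun θ => -(β * r θ ω)) := fun ω =>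
    isProbabilityMeasure_tilted (hexp ω)
  have hprobR := isProbabilityMeasure_tilted hexpR
  have hGibbs : ∀ ω, (Gibbs π fun θ => -(β * r θ ω)) = π.tilted fun θ => -(β * r θ ω) :=
    fun ω => Gibbs_eq_tilted π (hexp ω)
  simp_rw [hGibbs]
  have hpost : ∀ {g : Θ → Ω → ℝ}, Measurable (Function.uncurry g) → (∀ θ ω, |g θ ω| ≤ 1) →
      Integrable (fun ω => ∫ θ, g θ ω ∂(π.tilted fun θ' => -(β * r θ' ω))) P := by
    intro g hg hg1
    refine integrable_of_measurable_of_abs_le (C := 1) ?_ fun ω => ?_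
    · simp_rw [integral_tilted, smul_eq_mul]
      have hE : Measurable fun p : Ω × Θ => Real.exp (-(β * r p.2 p.1)) :=
        (((hr.comp measurable_swap).const_mul β).neg).exp
      have hZ : Measurable fun ω => ∫ θ, Real.exp (-(β * r θ ω)) ∂π :=
        (hE.stronglyMeasurable.integral_prod_right (ν := π)).measurable
      have hI : Measurable fun p : Ω × Θ => Real.exp (-(β * r p.2 p.1)) /
          (∫ θ, Real.exp (-(β * r θ p.1)) ∂π) * g p.2 p.1 :=
        (hE.div (hZ.comp measurable_fst)).mul (hg.comp measurable_swap)
      exact (hI.stronglyMeasurable.integral_prod_right (ν := π)).measurable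
    · refine (norm_integral_le_of_norm_le_const (f := fun θ => g θ ω) (C := 1)
        (Filter.Eventually.of_forall fun θ => hg1 θ ω)).trans ?_
      simp
  have hpostR := hpost (g := fun θ _ => R θ) (hRm.comp measurable_fst) fun θ _ => hR' θ
  have hpostr := hpost hr hr'
  set ZR := ∫ θ, Real.exp (-(β * R θ)) ∂π
  have hZR : 0 < ZR := integral_exp_pos hexpR
  let W : Ω → ℝ := fun ω => ∫ θ, Real.exp ((a - β) * R θ + (-lam) * r θ ω) ∂π
  let V : Ω → ℝ := fun ω => ∫ θ, (β * R θ + (-β) * r θ ω) ∂(π.tilted fun θ' => -(β * R θ'))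
  have hWint2 : Integrable (fun p : Θ × Ω => Real.exp ((a - β) * R p.1 + (-lam) * r p.1 p.2))
      (π.prod P) :=
    integrable_exp_of_measurable_of_abs_le (hlinm2 _ _) fun p => hlin _ _ p.1 p.2
  have hVint2 : Integrable (fun p : Θ × Ω => β * R p.1 + (-β) * r p.1 p.2)
      ((π.tilted fun θ' => -(β * R θ')).prod P) :=
    integrable_of_measurable_of_abs_le (hlinm2 _ _) fun p => hlin _ _ p.1 p.2
  have hWint : Integrable W P := hWint2.integral_prod_right
  have hVint : Integrable V P := hVint2.integral_prod_right
  have hV0 : ∫ ω, V ω ∂P = 0 := by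
    rw [← integral_integral_swap (f := fun θ ω => β * R θ + (-β) * r θ ω) hVint2]
    refine integral_eq_zero_of_ae (Filter.Eventually.of_forall fun θ => ?_)
    simp only [Pi.zero_apply]
    rw [integral_add (integrable_const _) ((hrint θ).const_mul _), integral_const_mul]
    simp [hR θ, integral_neg, integral_const_mul]
  have hWle : ∫ ω, W ω ∂P ≤ ZR := by
    rw [← integral_integral_swap
      (f := fun θ ω => Real.exp ((a - β) * R θ + (-lam) * r θ ω)) hWint2]
    refine integral_mono hWint2.integral_prod_left hexpR fun θ => ?_
    simp_rw [Real.exp_add, integral_const_mul]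
    calc Real.exp ((a - β) * R θ) * ∫ ω, Real.exp (-lam * r θ ω) ∂P
        ≤ Real.exp ((a - β) * R θ) * Real.exp (-(a * R θ)) := by
          gcongr
          simpa only [neg_mul] using hLaplace θ
      _ = Real.exp (-(β * R θ)) := by rw [← Real.exp_add]; ring_nf
  have key : ∀ ω, (a - β) * (∫ θ, R θ ∂(π.tilted fun θ' => -(β * r θ' ω))) -
      (lam - β) * (∫ θ, r θ ω ∂(π.tilted fun θ' => -(β * r θ' ω))) ≤ W ω / ZR - 1 - V ω := by
    intro ω
    have hW : 0 < W ω := integral_exp_pos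
      (integrable_exp_of_measurable_of_abs_le (hlinm _ _ ω) fun θ => hlin _ _ θ ω)
    have h1 := integral_tilted_le_log_sub_log π (hbrm ω) (hlinm (a - β) (β - lam) ω) (hbr ω)
      fun θ => hlin _ _ θ ω
    have h2 := integral_tilted_le_log_sub_log π hbRm (hlinm β (-β) ω) hbR
      fun θ => hlin _ _ θ ω
    rw [integral_add ((integrable_of_measurable_of_abs_le hRm hR').const_mul _)
      ((integrable_of_measurable_of_abs_le (hrθ ω) fun θ => hr' θ ω).const_mul _),
      integral_const_mul, integral_const_mul] at h1
    have e1 : ∀ θ, -(β * r θ ω) + ((a - β) * R θ + (β - lam) * r θ ω) =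
        (a - β) * R θ + (-lam) * r θ ω := fun θ => by ring
    have e2 : ∀ θ, -(β * R θ) + (β * R θ + (-β) * r θ ω) = -(β * r θ ω) := fun θ => by ring
    simp_rw [e1] at h1
    simp_rw [e2] at h2
    have h3 := Real.log_le_sub_one_of_pos (div_pos hW hZR)
    rw [Real.log_div hW.ne' hZR.ne'] at h3
    change V ω ≤ _ at h2
    change _ ≤ Real.log (W ω) - _ at h1
    linarith
  have hfin := integral_mono ((hpostR.const_mul (a - β)).sub (hpostr.const_mul (lam - β)))
    (((hWint.div_const ZR).sub (integrable_const 1)).sub hVint) key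
  simp only [Pi.sub_apply] at hfin
  rw [integral_sub (hpostR.const_mul _) (hpostr.const_mul _), integral_const_mul,
    integral_const_mul, integral_sub (by exact (hWint.div_const ZR).sub (integrable_const 1)) hVint,
    integral_sub (hWint.div_const ZR) (integrable_const 1), hV0, integral_div] at hfin
  have : (∫ ω, W ω ∂P) / ZR ≤ 1 := (div_le_one hZR).2 hWle
  simp only [integral_const, probReal_univ, smul_eq_mul, mul_one] at hfin
  linarith

lemma measurableSet_misclassified {𝒳 𝒴 Θ : Type*} [MeasurableSpace 𝒳] [MeasurableSpace 𝒴]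
    [Countable 𝒴] [MeasurableSingletonClass 𝒴] [MeasurableSpace Θ]
    {f : Θ → 𝒳 → 𝒴} (hf : Measurable fun p : Θ × 𝒳 => f p.1 p.2) :
    MeasurableSet {p : Θ × (𝒳 × 𝒴) | f p.1 p.2.1 = p.2.2} :=
  measurableSet_eq_fun
    (hf.comp (measurable_fst.prodMk (measurable_fst.comp measurable_snd)))
    (measurable_snd.comp measurable_snd)

lemma measurable_empErr {𝒳 𝒴 Θ : Type*} [MeasurableSpace 𝒳] [MeasurableSpace 𝒴]
    [Countable 𝒴] [DecidableEq 𝒴] [MeasurableSingletonClass 𝒴] [MeasurableSpace Θ]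
    (N : ℕ) {f : Θ → 𝒳 → 𝒴} (hf : Measurable fun p : Θ × 𝒳 => f p.1 p.2) :
    Measurable (Function.uncurry (empErr N f)) := by
  refine (Finset.measurable_sum _ fun i _ => ?_).const_mul _
  have hp : Measurable fun p : Θ × (Fin N → 𝒳 × 𝒴) => (p.1, p.2 i) :=
    measurable_fst.prodMk ((measurable_pi_apply i).comp measurable_snd)
  exact Measurable.ite (hp (measurableSet_misclassified hf)) measurable_const measurable_const

lemma empErr_mem_Icc {𝒳 𝒴 Θ : Type*} [DecidableEq 𝒴] {N : ℕ} (hN : 0 < N)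
    (f : Θ → 𝒳 → 𝒴) (θ : Θ) (ω : Fin N → 𝒳 × 𝒴) : empErr N f θ ω ∈ Set.Icc (0 : ℝ) 1 := by
  have hN' : (0 : ℝ) < N := Nat.cast_pos.2 hN
  have hle : (∑ i, if f θ (ω i).1 = (ω i).2 then (0 : ℝ) else 1) ≤ ∑ _i : Fin N, 1 :=
    Finset.sum_le_sum fun i _ => by split_ifs <;> norm_num
  have hge : 0 ≤ ∑ i, if f θ (ω i).1 = (ω i).2 then (0 : ℝ) else 1 :=
    Finset.sum_nonneg fun i _ => by split_ifs <;> norm_num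
  simp only [Finset.sum_const, Finset.card_univ, Fintype.card_fin, nsmul_eq_mul, mul_one] at hle
  refine ⟨mul_nonneg (inv_nonneg.2 hN'.le) hge, ?_⟩
  unfold empErr
  rw [inv_mul_le_iff₀ hN', mul_one]
  exact hle

lemma expErr_eq_integral_empErr {𝒳 𝒴 Θ : Type*} [MeasurableSpace 𝒳] [MeasurableSpace 𝒴]
    [Countable 𝒴] [DecidableEq 𝒴] [MeasurableSingletonClass 𝒴] [MeasurableSpace Θ]
    (N : ℕ) (P : Measure (Fin N → 𝒳 × 𝒴)) [IsProbabilityMeasure P]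
    {f : Θ → 𝒳 → 𝒴} (hf : Measurable fun p : Θ × 𝒳 => f p.1 p.2) (θ : Θ) :
    expErr N P f θ = ∫ ω, empErr N f θ ω ∂P := by
  have hS : ∀ i, MeasurableSet {ω : Fin N → 𝒳 × 𝒴 | f θ (ω i).1 ≠ (ω i).2} := fun i => by
    have hp : Measurable fun ω : Fin N → 𝒳 × 𝒴 => (θ, ω i) :=
      measurable_const.prodMk (measurable_pi_apply i)
    exact (hp (measurableSet_misclassified hf)).compl
  have heq : ∀ i, (fun ω : Fin N → 𝒳 × 𝒴 => if f θ (ω i).1 = (ω i).2 then (0 : ℝ) else 1) =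
      Set.indicator {ω | f θ (ω i).1 ≠ (ω i).2} 1 := fun i => by
    ext ω
    by_cases h : f θ (ω i).1 = (ω i).2 <;> simp [h]
  unfold expErr empErr
  rw [integral_const_mul, integral_finsetSum]
  · refine congrArg _ (Finset.sum_congr rfl fun i _ => ?_)
    rw [heq i, integral_indicator_one (hS i)]
    rfl
  · intro i _
    rw [heq i]
    exact (integrable_const (1 : ℝ)).indicator (hS i)

lemma integral_exp_neg_empErr_le {𝒳 𝒴 Θ : Type*} [MeasurableSpace 𝒳] [MeasurableSpace 𝒴]
    [Countable 𝒴] [DecidableEq 𝒴] [MeasurableSingletonClass 𝒴] [MeasurableSpace Θ]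
    {N : ℕ} (hN : 0 < N) (Ps : Fin N → Measure (𝒳 × 𝒴)) [∀ i, IsProbabilityMeasure (Ps i)]
    {f : Θ → 𝒳 → 𝒴} (hf : Measurable fun p : Θ × 𝒳 => f p.1 p.2) (lam : ℝ) (θ : Θ) :
    ∫ ω, Real.exp (-(lam * empErr N f θ ω)) ∂(Measure.pi Ps) ≤
      Real.exp (-((N : ℝ) * (1 - Real.exp (-(lam / N))) * expErr N (Measure.pi Ps) f θ)) := by
  have hN' : (N : ℝ) ≠ 0 := Nat.cast_ne_zero.2 hN.ne'
  have hS : MeasurableSet {z : 𝒳 × 𝒴 | f θ z.1 ≠ z.2} :=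
    (measurable_prodMk_left (measurableSet_misclassified hf)).compl
  have hleft : ∀ ω : Fin N → 𝒳 × 𝒴, Real.exp (-(lam * empErr N f θ ω)) =
      ∏ i, Real.exp (-(lam / N) * if f θ (ω i).1 = (ω i).2 then 0 else 1) := fun ω => by
    rw [← Real.exp_sum, ← Finset.mul_sum]
    unfold empErr
    congr 1
    ring
  have hmarg : ∀ i, ((Measure.pi Ps) {ω | f θ (ω i).1 ≠ (ω i).2}).toReal =
      (Ps i).real {z | f θ z.1 ≠ z.2} := fun i => by
    rw [measureReal_def, ← (measurePreserving_eval Ps i).measure_preimage hS.nullMeasurableSet]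
    rfl
  have hright : -((N : ℝ) * (1 - Real.exp (-(lam / N))) * expErr N (Measure.pi Ps) f θ) =
      ∑ i, -((1 - Real.exp (-(lam / N))) * (Ps i).real {z | f θ z.1 ≠ z.2}) := by
    unfold expErr
    simp_rw [hmarg]
    rw [Finset.sum_neg_distrib, ← Finset.mul_sum]
    field_simp
  simp_rw [hleft]
  rw [integral_fintype_prod_eq_prod (𝕜 := ℝ) (f := fun i (z : 𝒳 × 𝒴) =>
    Real.exp (-(lam / N) * if f θ z.1 = z.2 then 0 else 1)), hright, Real.exp_sum]
  refine Finset.prod_le_prod (fun i _ => integral_nonneg fun z => (Real.exp_pos _).le)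
    fun i _ => ?_
  have heq : ∀ z : 𝒳 × 𝒴, Real.exp (-(lam / N) * if f θ z.1 = z.2 then 0 else 1) =
      1 - (1 - Real.exp (-(lam / N))) * Set.indicator {z | f θ z.1 ≠ z.2} 1 z := fun z => by
    by_cases h : f θ z.1 = z.2 <;> simp [h]
  simp_rw [heq]
  rw [integral_sub (integrable_const _) (by
    exact ((integrable_const (1 : ℝ)).indicator hS).const_mul _),
    integral_const_mul, integral_indicator_one hS]
  simp only [integral_const, probReal_univ, smul_eq_mul, mul_one]
  linarith [Real.add_one_le_exp
    (-((1 - Real.exp (-(lam / N))) * (Ps i).real {z | f θ z.1 ≠ z.2}))]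

lemma exp_neg_le_one_sub_add_sq_div_two {x : ℝ} (hx : 0 ≤ x) :
    Real.exp (-x) ≤ 1 - x + x ^ 2 / 2 := by
  rw [Real.exp_neg, inv_le_iff_one_le_mul₀ (Real.exp_pos x)]
  nlinarith [Real.quadratic_le_exp_of_nonneg hx, sq_nonneg (x - 1), sq_nonneg (x ^ 2)]


/-- Gibbs posterior bound (Corollary `cor3.2` of Catoni): for `0 < β < N`,
`P[π_{exp(-βr)}(r)] ≤ P[π_{exp(-βr)}(R)]
  ≤ inf_{λ > -N log(1-β/N)} ((λ-β)/(N(1-exp(-λ/N))-β)) P[π_{exp(-βr)}(r)]`,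
and for `β < N/2`, `P[π_{exp(-βr)}(R)] ≤ (1-2β/N)⁻¹ P[π_{exp(-βr)}(r)]`. -/
theorem statement_9 {𝒳 𝒴 Θ : Type*} [MeasurableSpace 𝒳] [MeasurableSpace 𝒴]
    [Fintype 𝒴] [DecidableEq 𝒴] [MeasurableSingletonClass 𝒴] [MeasurableSpace Θ]
    (N : ℕ) (hN : 0 < N)
    (Ps : Fin N → Measure (𝒳 × 𝒴)) [∀ i, IsProbabilityMeasure (Ps i)]
    (P : Measure (Fin N → 𝒳 × 𝒴)) [IsProbabilityMeasure P] (hP : P = Measure.pi Ps)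
    (f : Θ → 𝒳 → 𝒴) (hf : Measurable fun p : Θ × 𝒳 => f p.1 p.2)
    (π : Measure Θ) [IsProbabilityMeasure π]
    (β : ℝ) (hβ0 : 0 < β) (hβN : β < N) :
    (∫ ω, (∫ θ, empErr N f θ ω ∂(Gibbs π (fun θ' => -(β * empErr N f θ' ω)))) ∂P
        ≤ ∫ ω, (∫ θ, expErr N P f θ ∂(Gibbs π (fun θ' => -(β * empErr N f θ' ω)))) ∂P)
    ∧ (∀ lam : ℝ, -(N : ℝ) * Real.log (1 - β / N) < lam →
        ∫ ω, (∫ θ, expErr N P f θ ∂(Gibbs π (fun θ' => -(β * empErr N f θ' ω)))) ∂P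
          ≤ ((lam - β) / ((N : ℝ) * (1 - Real.exp (-(lam / N))) - β)) *
              ∫ ω, (∫ θ, empErr N f θ ω
                  ∂(Gibbs π (fun θ' => -(β * empErr N f θ' ω)))) ∂P)
    ∧ (β < N / 2 →
        ∫ ω, (∫ θ, expErr N P f θ ∂(Gibbs π (fun θ' => -(β * empErr N f θ' ω)))) ∂P
          ≤ (1 - 2 * β / N)⁻¹ *
              ∫ ω, (∫ θ, empErr N f θ ω
                  ∂(Gibbs π (fun θ' => -(β * empErr N f θ' ω)))) ∂P) := by
  have hN' : (0 : ℝ) < N := Nat.cast_pos.2 hN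
  have bound : ∀ lam : ℝ, _ := fun lam =>
    integral_gibbs_posterior_le π P (measurable_empErr N hf) (empErr_mem_Icc hN f)
      (expErr_eq_integral_empErr N P hf) β lam ((N : ℝ) * (1 - Real.exp (-(lam / N))))
      fun θ => by subst hP; exact integral_exp_neg_empErr_le hN Ps hf lam θ
  have hr0 : 0 ≤ ∫ ω, (∫ θ, empErr N f θ ω
      ∂(Gibbs π (fun θ' => -(β * empErr N f θ' ω)))) ∂P :=
    integral_nonneg fun ω => integral_nonneg fun θ => (empErr_mem_Icc hN f θ ω).1
  refine ⟨?_, fun lam hlam => ?_, fun hβ => ?_⟩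
  · have h := bound 0
    simp only [zero_div, neg_zero, Real.exp_zero, sub_self, mul_zero, zero_sub, neg_mul,
      neg_le_neg_iff] at h
    exact le_of_mul_le_mul_left h hβ0
  · have hb : 0 < 1 - β / N := sub_pos.2 ((div_lt_one hN').2 hβN)
    have hexp : Real.exp (-(lam / N)) < 1 - β / N := by
      rw [← Real.lt_log_iff_exp_lt hb, neg_lt, lt_div_iff₀ hN']
      linarith
    have hpos : 0 < (N : ℝ) * (1 - Real.exp (-(lam / N))) - β := by
      have h := mul_lt_mul_of_pos_left hexp hN'
      rw [mul_sub, mul_div_cancel₀ _ hN'.ne'] at h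
      linarith
    rw [div_mul_eq_mul_div, le_div_iff₀ hpos, mul_comm]
    exact bound lam
  · have h := bound (2 * β)
    have hexp := exp_neg_le_one_sub_add_sq_div_two (x := 2 * β / N) (by positivity)
    have hb : 0 < 1 - 2 * β / N := sub_pos.2 ((div_lt_one hN').2 (by linarith))
    have hcoef : β * (1 - 2 * β / N) ≤ (N : ℝ) * (1 - Real.exp (-(2 * β / N))) - β := by
      have h := mul_le_mul_of_nonneg_left hexp hN'.le
      have e : (N : ℝ) * (1 - 2 * β / N + (2 * β / N) ^ 2 / 2) =
          N - 2 * β + β * (2 * β / N) := by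
        field_simp
      linarith
    have hR0 : 0 ≤ ∫ ω, (∫ θ, expErr N P f θ
        ∂(Gibbs π (fun θ' => -(β * empErr N f θ' ω)))) ∂P :=
      integral_nonneg fun ω => integral_nonneg fun θ =>
        mul_nonneg (inv_nonneg.2 hN'.le) (Finset.sum_nonneg fun _ _ => ENNReal.toReal_nonneg)
    rw [inv_mul_eq_div, le_div_iff₀ hb, mul_comm]
    refine le_of_mul_le_mul_left ?_ hβ0
    rw [← mul_assoc]
    refine (mul_le_mul_of_nonneg_right hcoef hR0).trans (h.trans_eq ?_)
    ring
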